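/- arXiv:1909.03381 — 2 statements merged into one kernel-verified Lean document; each statement's English description precedes it below -/
import Mathlib

section
/- For integers n and gamma with ceil(n/3) < gamma <= floor(n/2), the minimum status of the caterpillar C_n(ceil((3*gamma - n)/2), floor((3*gamma - n)/2)) equals 3*n*gamma + 3*gamma - n - ceil((n^2 + 18*gamma^2)/4). -/
open SimpleGraph

variable {V : Type*}

/-- The status of a vertex: sum of distances to all other vertices. -/
noncomputable def status [Fintype V] (G : SimpleGraph V) (u : V) : ℕ :=
  ∑ v : V, G.dist u v

/-- The minimum status of a graph. -/
noncomputable def minStatus [Fintype V] (G : SimpleGraph V) : ℕ :=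
  sInf (Set.range (status G))

/-- The matching number: maximum cardinality of a matching. -/
noncomputable def matchingNumber (G : SimpleGraph V) : ℕ :=
  sSup {k | ∃ M : G.Subgraph, M.IsMatching ∧ M.edgeSet.ncard = k}

/-- The domination number: minimum cardinality of a dominating set. -/
noncomputable def domNumber (G : SimpleGraph V) : ℕ :=
  sInf {k | ∃ S : Set V, (∀ v ∉ S, ∃ u ∈ S, G.Adj u v) ∧ S.ncard = k}

/-- The dumbbell `D_n(p,q)`: a path on `n - p - q` vertices `0, …, n-p-q-1`,
with `p` pendant vertices attached to vertex `0` and `q` pendant vertices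
attached to vertex `n-p-q-1`. -/
def dumbbell (n p q : ℕ) : SimpleGraph (Fin n) :=
  SimpleGraph.fromRel (fun a b =>
    ((a : ℕ) + 1 = (b : ℕ) ∧ (b : ℕ) < n - p - q) ∨
    ((a : ℕ) = 0 ∧ n - p - q ≤ (b : ℕ) ∧ (b : ℕ) < n - q) ∨
    ((a : ℕ) = n - p - q - 1 ∧ n - q ≤ (b : ℕ)))

/-- The tree `A_{n,m}`: a star with center `0` and leaves `1, …, n-m`, with one
pendant vertex `n-m+i` attached to leaf `i` for each `i = 1, …, m-1`. -/
def treeA (n m : ℕ) : SimpleGraph (Fin n) :=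
  SimpleGraph.fromRel (fun a b =>
    ((a : ℕ) = 0 ∧ 1 ≤ (b : ℕ) ∧ (b : ℕ) ≤ n - m) ∨
    (1 ≤ (a : ℕ) ∧ (a : ℕ) ≤ m - 1 ∧ (b : ℕ) = n - m + (a : ℕ)))

/-- The caterpillar `C_n(p,q)`: a path on vertices `0, …, n-p-q-1`; pendant
vertex `n-p-q+j` is attached to path vertex `j` for `j = 0, …, p-1`, and pendant
vertex `n-q+j` is attached to path vertex `n-p-2q+j` for `j = 0, …, q-1`. -/
def caterpillar (n p q : ℕ) : SimpleGraph (Fin n) :=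
  SimpleGraph.fromRel (fun a b =>
    ((a : ℕ) + 1 = (b : ℕ) ∧ (b : ℕ) < n - p - q) ∨
    (n - p - q ≤ (b : ℕ) ∧ (b : ℕ) < n - q ∧ (a : ℕ) = (b : ℕ) - (n - p - q)) ∨
    (n - q ≤ (b : ℕ) ∧ (a : ℕ) = (b : ℕ) - p - q))

/-- A function that vanishes at `u`, is `1`-Lipschitz along edges and can be decreased by one along
some edge at every vertex other than `u` is the distance to `u`. -/
theorem SimpleGraph.dist_eq_of_potential {G : SimpleGraph V} {u : V} {φ : V → ℕ} (h0 : φ u = 0)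
    (hlip : ∀ a b, G.Adj a b → φ b ≤ φ a + 1)
    (hdesc : ∀ v, v ≠ u → ∃ w, G.Adj w v ∧ φ v = φ w + 1) (v : V) : G.dist u v = φ v := by
  have upper : ∀ k v, φ v = k → ∃ w : G.Walk u v, w.length = k := by
    intro k
    induction k with
    | zero =>
      intro v hv
      by_cases h : v = u
      · subst h
        exact ⟨Walk.nil, rfl⟩
      · obtain ⟨w, -, hw⟩ := hdesc v h
        omega
    | succ k ih =>
      intro v hv
      have h : v ≠ u := by
        rintro rfl
        omega
      obtain ⟨w, hadj, hw⟩ := hdesc v h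
      obtain ⟨W, hW⟩ := ih w (by omega)
      exact ⟨W.concat hadj, by rw [Walk.length_concat, hW]⟩
  have lower : ∀ {a b : V} (W : G.Walk a b), φ b ≤ φ a + W.length := by
    intro a b W
    induction W with
    | nil => simp
    | cons h W ih =>
      have := hlip _ _ h
      rw [Walk.length_cons]
      omega
  obtain ⟨W, hW⟩ := upper _ v rfl
  obtain ⟨W', hW'⟩ := W.reachable.exists_walk_length_eq_dist
  have h1 := dist_le W
  have h2 := lower W'
  omega

/-- The position on the spine of the caterpillar at which the vertex `v` is attached. -/
def caterpillarFoot (m p q v : ℕ) : ℕ :=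
  if v < m then v else if v < m + p then v - m else v - p - q

/-- The distance from the vertex `v` of the caterpillar to the spine. -/
def caterpillarHeight (m v : ℕ) : ℕ := if v < m then 0 else 1

theorem caterpillarFoot_lt {m p q v : ℕ} (hp : p ≤ m) (hq : q ≤ m) (hv : v < m + p + q) :
    caterpillarFoot m p q v < m := by
  simp only [caterpillarFoot]
  split_ifs <;> omega

theorem caterpillar_adj_iff {m p q : ℕ} (a b : Fin (m + p + q)) :
    (caterpillar (m + p + q) p q).Adj a b ↔ (a : ℕ) ≠ b ∧
      ((((a : ℕ) + 1 = b ∧ (b : ℕ) < m) ∨ (m ≤ (b : ℕ) ∧ (b : ℕ) < m + p ∧ (a : ℕ) = b - m) ∨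
        (m + p ≤ (b : ℕ) ∧ (a : ℕ) = b - p - q)) ∨
      (((b : ℕ) + 1 = a ∧ (a : ℕ) < m) ∨ (m ≤ (a : ℕ) ∧ (a : ℕ) < m + p ∧ (b : ℕ) = a - m) ∨
        (m + p ≤ (a : ℕ) ∧ (b : ℕ) = a - p - q))) := by
  have e1 : m + p + q - p - q = m := by omega
  have e2 : m + p + q - q = m + p := by omega
  simp only [caterpillar, fromRel_adj, e1, e2, ne_eq, Fin.ext_iff]

theorem caterpillarFoot_cases {m p q : ℕ} (hq : q ≤ m) (v : ℕ) :
    (v < m ∧ caterpillarFoot m p q v = v ∧ caterpillarHeight m v = 0) ∨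
    (m ≤ v ∧ v < m + p ∧ caterpillarFoot m p q v + m = v ∧ caterpillarHeight m v = 1) ∨
    (m + p ≤ v ∧ caterpillarFoot m p q v + p + q = v ∧ caterpillarHeight m v = 1) := by
  simp only [caterpillarFoot, caterpillarHeight]
  split_ifs <;> omega

theorem caterpillar_foot_height_of_adj {m p q : ℕ} (hp : p ≤ m) (hq : q ≤ m)
    {a b : Fin (m + p + q)} (hab : (caterpillar (m + p + q) p q).Adj a b) :
    ((caterpillarFoot m p q a : ℤ) - caterpillarFoot m p q b).natAbs
      + caterpillarHeight m a + caterpillarHeight m b = 1 := by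
  rw [caterpillar_adj_iff] at hab
  have ha := a.isLt
  have hb := b.isLt
  have ca := caterpillarFoot_cases (p := p) hq a
  have cb := caterpillarFoot_cases (p := p) hq b
  omega

theorem caterpillar_dist {m p q : ℕ} (hp : p ≤ m) (hq : q ≤ m) (u v : Fin (m + p + q)) :
    (caterpillar (m + p + q) p q).dist u v =
      if u = v then 0 else
        ((caterpillarFoot m p q u : ℤ) - caterpillarFoot m p q v).natAbs
          + caterpillarHeight m u + caterpillarHeight m v := by
  refine SimpleGraph.dist_eq_of_potential (φ := fun v : Fin (m + p + q) =>
    if u = v then 0 else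
        ((caterpillarFoot m p q u : ℤ) - caterpillarFoot m p q v).natAbs
          + caterpillarHeight m u + caterpillarHeight m v) (if_pos rfl) ?_ ?_ v
  · intro a b hab
    have h := caterpillar_foot_height_of_adj hp hq hab
    by_cases hua : u = a
    · subst hua
      split_ifs <;> omega
    · simp only [if_neg hua]
      split_ifs <;> omega
  · intro v hv
    have hu := u.isLt
    have hvl := v.isLt
    have hne : (u : ℕ) ≠ v := fun h => hv (Fin.ext h.symm)
    have hfoot := caterpillarFoot_lt hp hq hu
    have cu := caterpillarFoot_cases (p := p) hq u
    have cv := caterpillarFoot_cases (p := p) hq v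
    have hfootv := caterpillarFoot_lt hp hq hvl
    simp only [caterpillar_adj_iff, Fin.ext_iff, if_neg hne]
    by_cases h1 : (v : ℕ) < m
    · rcases lt_trichotomy (v : ℕ) (caterpillarFoot m p q u) with h | h | h
      · refine ⟨⟨v + 1, by omega⟩, ?_⟩
        have cw := caterpillarFoot_cases (p := p) hq (v + 1)
        dsimp only
        split_ifs <;> omega
      · refine ⟨u, ?_⟩
        rw [if_pos rfl]
        omega
      · refine ⟨⟨v - 1, by omega⟩, ?_⟩
        have cw := caterpillarFoot_cases (p := p) hq (v - 1)
        dsimp only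
        split_ifs <;> omega
    · refine ⟨⟨caterpillarFoot m p q v, by omega⟩, ?_⟩
      have cw := caterpillarFoot_cases (p := p) hq (caterpillarFoot m p q v)
      have hw : caterpillarFoot m p q (caterpillarFoot m p q v) = caterpillarFoot m p q v ∧
          caterpillarHeight m (caterpillarFoot m p q v) = 0 := by omega
      clear cw
      dsimp only
      rw [hw.1, hw.2]
      refine ⟨by omega, ?_⟩
      split_ifs <;> omega

/-- Twice the status of a spine vertex `x` of the caterpillar, provided that `x` lies between the
two groups of pendant vertices. -/
def caterpillarQuad (m p q x : ℤ) : ℤ :=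
  x * (x + 1) + (m - 1 - x) * (m - x) + (2 * p * x - p * (p - 1))
    + (2 * q * (m - q - x) + q * (q - 1)) + 2 * (p + q)

theorem two_mul_sum_range_abs_sub (m x : ℕ) (hx : x < m) :
    2 * ∑ i ∈ Finset.range m, |(x : ℤ) - i| = x * (x + 1) + (m - 1 - x) * (m - x) := by
  induction m, hx using Nat.le_induction with
  | base =>
    have h : ∀ y : ℕ, 2 * ∑ i ∈ Finset.range (y + 1), ((y : ℤ) - i) = y * (y + 1) := by
      intro y
      induction y with
      | zero => simp
      | succ y ih =>
        rw [Finset.sum_range_succ]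
        have : ∀ i ∈ Finset.range (y + 1), (((y + 1 : ℕ) : ℤ) - i) = ((y : ℤ) - i) + 1 := by
          intros
          push_cast
          ring
        rw [Finset.sum_congr rfl this, Finset.sum_add_distrib, mul_add, mul_add, ih]
        simp
        ring
    rw [Finset.sum_congr rfl (g := fun i : ℕ => (x : ℤ) - i), h]
    · push_cast
      ring
    · intro i hi
      rw [Finset.mem_range] at hi
      exact abs_of_nonneg (by omega)
  | succ m hm ih =>
    rw [Finset.sum_range_succ, mul_add, ih, abs_of_nonpos (by omega)]
    push_cast
    ring

theorem two_mul_sum_range_cast (p : ℕ) : 2 * ∑ j ∈ Finset.range p, (j : ℤ) = p * (p - 1) := by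
  induction p with
  | zero => simp
  | succ p ih =>
    rw [Finset.sum_range_succ, mul_add, ih]
    push_cast
    ring

theorem two_mul_sum_range_sub (p : ℕ) (x : ℤ) :
    2 * ∑ j ∈ Finset.range p, (x - j) = 2 * p * x - p * (p - 1) := by
  rw [Finset.sum_sub_distrib, mul_sub, two_mul_sum_range_cast]
  simp
  ring

theorem two_mul_sum_range_add_sub (q : ℕ) (x y : ℤ) :
    2 * ∑ j ∈ Finset.range q, (y + j - x) = 2 * q * (y - x) + q * (q - 1) := by
  have h : ∀ j ∈ Finset.range q, y + (j : ℤ) - x = (y - x) + j := by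
    intros
    ring
  rw [Finset.sum_congr rfl h, Finset.sum_add_distrib, mul_add, two_mul_sum_range_cast]
  simp
  ring

/-- The sum of `|x - foot v| + height v` over all vertices `v` of the caterpillar. -/
theorem sum_foot_height (m p q : ℕ) (hq : q ≤ m) (x : ℤ) :
    ∑ v ∈ Finset.range (m + p + q), (|x - caterpillarFoot m p q v| + (caterpillarHeight m v : ℤ))
      = ∑ i ∈ Finset.range m, |x - i| + ∑ j ∈ Finset.range p, |x - j|
        + ∑ j ∈ Finset.range q, |x - (m - q + j)| + (p + q) := by
  have h1 : ∀ i ∈ Finset.range m,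
      |x - caterpillarFoot m p q i| + (caterpillarHeight m i : ℤ) = |x - i| := by
    intro i hi
    rw [Finset.mem_range] at hi
    simp [caterpillarFoot, caterpillarHeight, hi]
  have h2 : ∀ j ∈ Finset.range p,
      |x - caterpillarFoot m p q (m + j)| + (caterpillarHeight m (m + j) : ℤ) = |x - j| + 1 := by
    intro j hj
    rw [Finset.mem_range] at hj
    simp [caterpillarFoot, caterpillarHeight, hj]
  have h3 : ∀ j ∈ Finset.range q,
      |x - caterpillarFoot m p q (m + p + j)| + (caterpillarHeight m (m + p + j) : ℤ)
        = |x - (m - q + j)| + 1 := by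
    intro j hj
    have e : caterpillarFoot m p q (m + p + j) = m - q + j := by
      simp only [caterpillarFoot]
      split_ifs <;> omega
    have e' : caterpillarHeight m (m + p + j) = 1 := by
      simp only [caterpillarHeight]
      split_ifs <;> omega
    rw [e, e']
    push_cast [hq]
    rfl
  rw [Finset.sum_range_add, Finset.sum_range_add, Finset.sum_congr rfl h1,
    Finset.sum_congr rfl h2, Finset.sum_congr rfl h3, Finset.sum_add_distrib,
    Finset.sum_add_distrib]
  simp
  ring

theorem caterpillarQuad_le (m p q x : ℕ) (hq : q ≤ m) (hx : x < m) :
    caterpillarQuad m p q x ≤ 2 * ∑ v ∈ Finset.range (m + p + q),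
      (|(x : ℤ) - caterpillarFoot m p q v| + (caterpillarHeight m v : ℤ)) := by
  rw [sum_foot_height m p q hq, caterpillarQuad, ← two_mul_sum_range_abs_sub m x hx,
    ← two_mul_sum_range_sub, ← two_mul_sum_range_add_sub]
  have h1 : ∑ j ∈ Finset.range p, ((x : ℤ) - j) ≤ ∑ j ∈ Finset.range p, |(x : ℤ) - j| :=
    Finset.sum_le_sum fun j _ => le_abs_self _
  have h2 : ∑ j ∈ Finset.range q, ((m : ℤ) - q + j - x)
      ≤ ∑ j ∈ Finset.range q, |(x : ℤ) - (m - q + j)| :=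
    Finset.sum_le_sum fun j _ => by
      rw [abs_sub_comm]
      exact le_abs_self _
  linarith

theorem caterpillarQuad_eq (m p q x : ℕ) (hx : x < m) (hpx : p ≤ x + 1)
    (hxq : x + q ≤ m) :
    2 * ∑ v ∈ Finset.range (m + p + q),
      (|(x : ℤ) - caterpillarFoot m p q v| + (caterpillarHeight m v : ℤ))
        = caterpillarQuad m p q x := by
  rw [sum_foot_height m p q (by omega), caterpillarQuad, ← two_mul_sum_range_abs_sub m x hx,
    ← two_mul_sum_range_sub, ← two_mul_sum_range_add_sub]
  have h1 : ∑ j ∈ Finset.range p, ((x : ℤ) - j) = ∑ j ∈ Finset.range p, |(x : ℤ) - j| :=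
    Finset.sum_congr rfl fun j hj => by
      rw [Finset.mem_range] at hj
      rw [abs_of_nonneg (by omega)]
  have h2 : ∑ j ∈ Finset.range q, ((m : ℤ) - q + j - x)
      = ∑ j ∈ Finset.range q, |(x : ℤ) - (m - q + j)| :=
    Finset.sum_congr rfl fun j _ => by
      rw [abs_of_nonpos (by omega)]
      ring
  linarith

theorem status_caterpillar {m p q : ℕ} (hp : p ≤ m) (hq : q ≤ m) (u : Fin (m + p + q)) :
    (status (caterpillar (m + p + q) p q) u : ℤ) =
      ∑ v ∈ Finset.range (m + p + q),
        (|(caterpillarFoot m p q u : ℤ) - caterpillarFoot m p q v| + (caterpillarHeight m v : ℤ))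
      + caterpillarHeight m u * (m + p + q - 2) := by
  have h : ∀ v : Fin (m + p + q), ((caterpillar (m + p + q) p q).dist u v : ℤ) =
      (|(caterpillarFoot m p q u : ℤ) - caterpillarFoot m p q v| + (caterpillarHeight m v : ℤ))
        + caterpillarHeight m u - if u = v then 2 * (caterpillarHeight m u : ℤ) else 0 := by
    intro v
    rw [caterpillar_dist hp hq]
    by_cases huv : u = v
    · subst huv
      simp
      ring
    · rw [if_neg huv, if_neg huv]
      push_cast
      ring
  rw [status, Nat.cast_sum, Finset.sum_congr rfl fun v _ => h v, Finset.sum_sub_distrib,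
    Finset.sum_add_distrib, ← Fin.sum_univ_eq_sum_range
      (fun v => |(caterpillarFoot m p q u : ℤ) - caterpillarFoot m p q v|
        + (caterpillarHeight m v : ℤ))]
  simp
  ring

/-- For a balanced caterpillar the middle vertex of the spine attains the minimum status. -/
theorem two_mul_minStatus_caterpillar {m p q c : ℕ} (hpq : p + q ≤ m) (hqp : q ≤ p)
    (hpq' : p ≤ q + 1) (hc : 2 * c + 1 ≤ m) (hc' : m ≤ 2 * c + 2) (hn : 2 ≤ m + p + q) :
    2 * (minStatus (caterpillar (m + p + q) p q) : ℤ) = caterpillarQuad m p q c := by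
  have hp : p ≤ m := by omega
  have hq : q ≤ m := by omega
  let c' : Fin (m + p + q) := ⟨c, by omega⟩
  have hcm : c < m := by omega
  have hfoot : caterpillarFoot m p q c' = c := by simp [caterpillarFoot, c', hcm]
  have hheight : caterpillarHeight m c' = 0 := by simp [caterpillarHeight, c', hcm]
  have hstat : 2 * (status (caterpillar (m + p + q) p q) c' : ℤ) = caterpillarQuad m p q c := by
    rw [status_caterpillar hp hq, hfoot, hheight,
      ← caterpillarQuad_eq m p q c hcm (by omega) (by omega)]
    simp
  have hmin : ∀ u, status (caterpillar (m + p + q) p q) c'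
      ≤ status (caterpillar (m + p + q) p q) u := by
    intro u
    have h1 := status_caterpillar hp hq u
    have h2 := caterpillarQuad_le m p q _ hq (caterpillarFoot_lt hp hq u.isLt)
    have h3 : (0 : ℤ) ≤ caterpillarHeight m u * (m + p + q - 2) :=
      mul_nonneg (by positivity) (by omega)
    generalize caterpillarFoot m p q u = x at h1 h2
    have h4 : caterpillarQuad m p q x - caterpillarQuad m p q c
        = 2 * ((x - c) * (x + c - (m - 1 - (p - q)))) := by
      simp only [caterpillarQuad]
      ring
    have h5 : (0 : ℤ) ≤ (x - c) * (x + c - (m - 1 - (p - q))) := by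
      rcases lt_trichotomy x c with h | h | h
      · exact mul_nonneg_of_nonpos_of_nonpos (by omega) (by omega)
      · simp [h]
      · exact mul_nonneg (by omega) (by omega)
    zify
    linarith
  have : minStatus (caterpillar (m + p + q) p q) = status (caterpillar (m + p + q) p q) c' :=
    le_antisymm (Nat.sInf_le ⟨c', rfl⟩)
      (le_csInf ⟨_, c', rfl⟩ (by rintro _ ⟨u, rfl⟩; exact hmin u))
  rw [this, hstat]

/-- The minimum status of `C_n(⌈(3γ-n)/2⌉, ⌊(3γ-n)/2⌋)` for `⌈n/3⌉ < γ ≤ ⌊n/2⌋`. -/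
theorem stmt15 (n γ : ℕ) (h1 : (n + 2) / 3 < γ) (h2 : 2 * γ ≤ n) :
    minStatus (caterpillar n ((3 * γ - n + 1) / 2) ((3 * γ - n) / 2))
      = 3 * n * γ + 3 * γ - n - (n ^ 2 + 18 * γ ^ 2 + 3) / 4 := by
  obtain ⟨k, hk⟩ : ∃ k, 3 * γ = n + k := ⟨3 * γ - n, by omega⟩
  have hk' : 3 * γ - n = k := by omega
  rw [hk']
  obtain ⟨m, hm⟩ : ∃ m, n = m + (k + 1) / 2 + k / 2 := ⟨n - k, by omega⟩
  have key := two_mul_minStatus_caterpillar (m := m) (p := (k + 1) / 2) (q := k / 2)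
    (c := (m - 1) / 2) (by omega) (by omega) (by omega) (by omega) (by omega) (by omega)
  rw [← hm] at key
  generalize minStatus (caterpillar n ((k + 1) / 2) (k / 2)) = S at key
  have e1 : 3 * n * γ = n * (n + k) := by rw [← hk]; ring
  have e2 : 18 * γ ^ 2 = 2 * (n + k) ^ 2 := by rw [← hk]; ring
  rw [e1, e2, hk]
  clear e1 e2 hk'
  have hfin : n * (n + k) + k = S + (n ^ 2 + 2 * (n + k) ^ 2 + 3) / 4 := by
    have hbounds : n ^ 2 + 2 * (n + k) ^ 2 ≤ 4 * (n * (n + k) + k - S : ℤ) ∧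
        4 * (n * (n + k) + k - S : ℤ) ≤ n ^ 2 + 2 * (n + k) ^ 2 + 3 := by
      obtain ⟨c, hc⟩ : ∃ c, c = (m - 1) / 2 := ⟨_, rfl⟩
      rw [← hc] at key
      obtain ⟨q, hq⟩ : ∃ q, q = k / 2 := ⟨_, rfl⟩
      have hm' : m = 2 * c + 1 ∨ m = 2 * c + 2 := by omega
      have hkq : (k = 2 * q ∧ (k + 1) / 2 = q) ∨ (k = 2 * q + 1 ∧ (k + 1) / 2 = q + 1) := by
        omega
      rw [← hq] at key hm
      simp only [caterpillarQuad] at key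
      rcases hm' with rfl | rfl <;> rcases hkq with ⟨rfl, e⟩ | ⟨rfl, e⟩ <;> rw [e] at key hm <;>
        subst hm <;> push_cast at key ⊢ <;> constructor <;> linarith
    zify
    omega
  omega
end

section
/- Let G be a connected graph on n vertices with domination number gamma, where ceil(n/3) < gamma <= floor(n/2). Then s(G) <= 3*n*gamma + 3*gamma - n - ceil((n^2 + 18*gamma^2)/4). -/
open SimpleGraph

variable {V : Type*}

section StatusBound

open Finset

/-- A rooted tree on `V`, given by a parent map (fixing the root) and a depth function. -/
structure ParentMap (V : Type*) where
  root : V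
  parent : V → V
  depth : V → ℕ
  depth_parent : ∀ v, depth (parent v) = depth v - 1
  depth_eq_zero : ∀ v, depth v = 0 ↔ v = root

namespace ParentMap

variable (T : ParentMap V)

lemma depth_root : T.depth T.root = 0 := (T.depth_eq_zero _).2 rfl

lemma parent_root : T.parent T.root = T.root := by
  rw [← T.depth_eq_zero, T.depth_parent, T.depth_root]

lemma iterate_parent_root (k : ℕ) : T.parent^[k] T.root = T.root :=
  Function.iterate_fixed T.parent_root k

lemma depth_pos {v : V} (h : v ≠ T.root) : 0 < T.depth v :=
  Nat.pos_of_ne_zero fun h0 => h ((T.depth_eq_zero v).1 h0)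

lemma depth_iterate (k : ℕ) (v : V) : T.depth (T.parent^[k] v) = T.depth v - k := by
  induction k with
  | zero => simp
  | succ k ih => rw [Function.iterate_succ_apply', T.depth_parent, ih]; omega

/-- `T.Desc v w` says that `w` is a (possibly improper) descendant of `v`. -/
def Desc (v w : V) : Prop := ∃ k, T.parent^[k] w = v

lemma desc_refl (v : V) : T.Desc v v := ⟨0, rfl⟩

lemma desc_root (v : V) : T.Desc T.root v :=
  ⟨T.depth v, by rw [← T.depth_eq_zero, T.depth_iterate, Nat.sub_self]⟩

variable {T}

lemma Desc.trans {u v w : V} (h : T.Desc u v) (h' : T.Desc v w) : T.Desc u w := by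
  obtain ⟨k, rfl⟩ := h
  obtain ⟨l, rfl⟩ := h'
  exact ⟨k + l, Function.iterate_add_apply _ _ _ _⟩

lemma Desc.of_parent {v w : V} (h : T.Desc v (T.parent w)) : T.Desc v w :=
  h.trans ⟨1, rfl⟩

lemma Desc.parent {v w : V} (h : T.Desc v w) (hne : w ≠ v) : T.Desc v (T.parent w) := by
  obtain ⟨k, rfl⟩ := h
  cases k with
  | zero => exact absurd rfl hne
  | succ k => exact ⟨k, rfl⟩

lemma Desc.depth_lt {v w : V} (h : T.Desc v w) (hne : w ≠ v) : T.depth v < T.depth w := by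
  obtain ⟨k, rfl⟩ := h
  rw [T.depth_iterate]
  rcases eq_or_ne w T.root with rfl | hw
  · exact absurd (T.iterate_parent_root k).symm hne
  · have := T.depth_pos hw
    rcases Nat.eq_zero_or_pos k with rfl | hk
    · exact absurd rfl hne
    · omega

lemma Desc.comparable {u v w : V} (hu : T.Desc u w) (hv : T.Desc v w) :
    T.Desc u v ∨ T.Desc v u := by
  obtain ⟨a, rfl⟩ := hu
  obtain ⟨b, rfl⟩ := hv
  rcases le_total a b with h | h
  · exact Or.inr ⟨b - a, by rw [← Function.iterate_add_apply, Nat.sub_add_cancel h]⟩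
  · exact Or.inl ⟨a - b, by rw [← Function.iterate_add_apply, Nat.sub_add_cancel h]⟩

variable (T)

lemma exists_branch {v : V} (h : v ≠ T.root) : ∃ u, T.depth u = 1 ∧ T.Desc u v :=
  ⟨T.parent^[T.depth v - 1] v, by have := T.depth_pos h; rw [T.depth_iterate]; omega, _, rfl⟩

/-- A leaf is a vertex without children. -/
def IsLeaf (v : V) : Prop := ∀ w, w ≠ T.root → T.parent w ≠ v

/-- A support vertex is a vertex with a child that is a leaf. -/
def IsSupport (v : V) : Prop := ∃ w, w ≠ T.root ∧ T.parent w = v ∧ T.IsLeaf w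

variable {T}

lemma IsLeaf.eq_of_desc {v w : V} (hv : T.IsLeaf v) (h : T.Desc v w) : w = v := by
  obtain ⟨k, hk⟩ := h
  induction k generalizing w with
  | zero => exact hk
  | succ k ih =>
    have hp := ih hk
    by_cases hw : w = T.root
    · rw [← hp, hw, T.parent_root]
    · exact absurd hp (hv w hw)

lemma IsSupport.not_isLeaf {v : V} (h : T.IsSupport v) : ¬ T.IsLeaf v := by
  obtain ⟨w, hw, hwv, -⟩ := h
  exact fun hl => hl w hw hwv

variable (T) [Fintype V]

open Classical in
/-- The set of descendants of a vertex. -/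
noncomputable def sub (v : V) : Finset V := univ.filter (T.Desc v)

open Classical in
/-- The set of support vertices. -/
noncomputable def supports : Finset V := univ.filter T.IsSupport

/-- The set of vertices with at most `j` descendants. -/
noncomputable def small (j : ℕ) : Finset V := univ.filter fun v => #(T.sub v) ≤ j

variable {T}

lemma mem_sub {v w : V} : w ∈ T.sub v ↔ T.Desc v w := by simp [sub]

lemma mem_supports {v : V} : v ∈ T.supports ↔ T.IsSupport v := by simp [supports]

lemma mem_small {j : ℕ} {v : V} : v ∈ T.small j ↔ #(T.sub v) ≤ j := by simp [small]

variable (T)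

lemma sub_root : T.sub T.root = univ := by
  ext v; simp [mem_sub, T.desc_root]

open Classical in
lemma depth_le_card_ancestors (w : V) :
    T.depth w ≤ #((univ.erase T.root).filter fun v => w ∈ T.sub v) := by
  have hinj : Set.InjOn (fun k => T.parent^[k] w) (range (T.depth w) : Set ℕ) := by
    intro a ha b hb hab
    have h := congrArg T.depth hab
    simp only [T.depth_iterate] at h
    simp only [coe_range, Set.mem_Iio] at ha hb
    omega
  calc T.depth w = #((range (T.depth w)).image fun k => T.parent^[k] w) := by
        rw [card_image_of_injOn hinj, card_range]
    _ ≤ _ := by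
        refine card_le_card fun v hv => ?_
        simp only [mem_image, mem_range] at hv
        obtain ⟨k, hk, rfl⟩ := hv
        simp only [mem_filter, mem_erase, mem_univ, and_true, mem_sub]
        refine ⟨fun h => ?_, k, rfl⟩
        have := (T.depth_eq_zero _).2 h
        rw [T.depth_iterate] at this
        omega

open Classical in
lemma sum_depth_le : ∑ w, T.depth w ≤ ∑ v ∈ univ.erase T.root, #(T.sub v) := by
  calc ∑ w, T.depth w
      ≤ ∑ w, #((univ.erase T.root).filter fun v => w ∈ T.sub v) :=
        sum_le_sum fun w _ => T.depth_le_card_ancestors w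
    _ = ∑ v ∈ univ.erase T.root, #(univ.filter fun w => w ∈ T.sub v) := by
        simp only [card_filter]
        exact sum_comm
    _ = _ := by simp

open Classical in
lemma sum_depth_add_sum_card_small_le (h : ℕ) (hh : h ≤ Fintype.card V)
    (hsub : ∀ v, v ≠ T.root → #(T.sub v) ≤ h) :
    ∑ w, T.depth w + ∑ j ∈ range h, #(T.small j) ≤ h * (Fintype.card V - 1) := by
  have key : ∀ j ∈ range h, #((univ.erase T.root).filter fun v => j < #(T.sub v)) + #(T.small j)
      = Fintype.card V - 1 := by
    intro j hj
    rw [mem_range] at hj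
    have hs : T.small j = (univ.erase T.root).filter fun v => ¬ j < #(T.sub v) := by
      ext v
      simp only [mem_small, mem_filter, mem_erase, mem_univ, and_true, not_lt]
      refine ⟨fun hv => ⟨?_, hv⟩, fun hv => hv.2⟩
      rintro rfl
      rw [T.sub_root, card_univ] at hv
      omega
    rw [hs, card_filter_add_card_filter_not, card_erase_of_mem (mem_univ _), card_univ]
  have hsum : ∑ v ∈ univ.erase T.root, #(T.sub v)
      = ∑ j ∈ range h, #((univ.erase T.root).filter fun v => j < #(T.sub v)) := by
    simp only [card_filter]
    rw [sum_comm]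
    refine sum_congr rfl fun v hv => ?_
    rw [← card_filter]
    have : (range h).filter (fun j => j < #(T.sub v)) = range #(T.sub v) := by
      ext j
      have := hsub v (ne_of_mem_erase hv)
      simp only [mem_filter, mem_range]
      omega
    rw [this, card_range]
  calc _ ≤ ∑ v ∈ univ.erase T.root, #(T.sub v) + ∑ j ∈ range h, #(T.small j) :=
        Nat.add_le_add_right T.sum_depth_le _
    _ = _ := by
        rw [hsum, ← sum_add_distrib, sum_congr rfl key, sum_const, card_range, smul_eq_mul]

open Classical in
/-- Two disjoint pieces of the set of small vertices, one inside and one outside a branch. -/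
lemma exists_disjoint_pieces {j : ℕ} (hj : 2 * (j + 1) ≤ Fintype.card V)
    (hsub : ∀ v, v ≠ T.root → 2 * #(T.sub v) ≤ Fintype.card V)
    (hx : ∃ x, x ≠ T.root ∧ j < #(T.sub x)) :
    ∃ A B : Finset V, Disjoint A B ∧ A ⊆ T.small j ∧ B ⊆ T.small j ∧ j ≤ #A ∧ j ≤ #B ∧
      (∃ x, ∀ w ∈ A, T.parent w ∈ A ∨ T.parent w = x) ∧
      (∃ y, ∀ w ∈ B, T.parent w ∈ B ∨ T.parent w = y) := by
  obtain ⟨x₀, hx₀, hx₀j⟩ := hx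
  obtain ⟨x, hxm, hxmax⟩ := exists_max_image
    (univ.filter fun x => x ≠ T.root ∧ j < #(T.sub x)) T.depth ⟨x₀, by simp [hx₀, hx₀j]⟩
  simp only [mem_filter, mem_univ, true_and] at hxm hxmax
  obtain ⟨hxr, hxj⟩ := hxm
  obtain ⟨u, hu, hux⟩ := T.exists_branch hxr
  have hur : u ≠ T.root := by
    rintro rfl
    rw [T.depth_root] at hu
    omega
  obtain ⟨y, hym, hymax⟩ := exists_max_image
    (univ.filter fun y => ¬ T.Desc u y ∧ j < #(T.sub y)) T.depth
    ⟨T.root, by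
      simp only [mem_filter, mem_univ, true_and, T.sub_root, card_univ]
      refine ⟨fun h => ?_, by omega⟩
      have := h.depth_lt hur.symm
      rw [T.depth_root] at this
      omega⟩
  simp only [mem_filter, mem_univ, true_and] at hym hymax
  obtain ⟨huy, hyj⟩ := hym
  refine ⟨(T.sub x).erase x, (T.sub y).erase y \ T.sub u, ?_, ?_, ?_, ?_, ?_,
    ⟨x, ?_⟩, ⟨y, ?_⟩⟩
  · rw [Finset.disjoint_left]
    intro w hw hw'
    exact (mem_sdiff.1 hw').2 (mem_sub.2 (hux.trans (mem_sub.1 (mem_of_mem_erase hw))))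
  · intro w hw
    rw [mem_erase, mem_sub] at hw
    have hlt := hw.2.depth_lt hw.1
    rw [mem_small]
    by_contra! hcon
    refine absurd (hxmax w ⟨?_, hcon⟩) (by omega)
    rintro rfl
    rw [T.depth_root] at hlt
    omega
  · intro w hw
    rw [mem_sdiff, mem_erase, mem_sub, mem_sub] at hw
    have hlt := hw.1.2.depth_lt hw.1.1
    rw [mem_small]
    by_contra! hcon
    exact absurd (hymax w ⟨hw.2, hcon⟩) (by omega)
  · rw [card_erase_of_mem (mem_sub.2 (T.desc_refl x))]
    omega
  · have hye := card_erase_of_mem (mem_sub.2 (T.desc_refl y))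
    by_cases hyr : y = T.root
    · have h1 := le_card_sdiff (T.sub u) ((T.sub y).erase y)
      have h2 : #(T.sub y) = Fintype.card V := by rw [hyr, T.sub_root, card_univ]
      have h3 := hsub u hur
      omega
    · rw [sdiff_eq_self_of_disjoint, hye]
      · omega
      · rw [Finset.disjoint_left]
        intro w hw hw'
        rw [mem_erase, mem_sub] at hw
        rw [mem_sub] at hw'
        rcases hw'.comparable hw.2 with h | h
        · exact huy h
        · have h1 := T.depth_pos hyr
          have h2 := h.depth_lt (by rintro rfl; exact huy (T.desc_refl _))
          omega
  · intro w hw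
    rw [mem_erase, mem_sub] at hw
    by_cases h : T.parent w = x
    · exact Or.inr h
    · exact Or.inl (mem_erase.2 ⟨h, mem_sub.2 (hw.2.parent hw.1)⟩)
  · intro w hw
    rw [mem_sdiff, mem_erase, mem_sub, mem_sub] at hw
    by_cases h : T.parent w = y
    · exact Or.inr h
    · refine Or.inl (mem_sdiff.2 ⟨mem_erase.2 ⟨h, mem_sub.2 (hw.1.2.parent hw.1.1)⟩, ?_⟩)
      exact fun h' => hw.2 (mem_sub.1 h').of_parent

lemma two_mul_le_card_small {j : ℕ} (hj : 2 * (j + 1) ≤ Fintype.card V)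
    (hsub : ∀ v, v ≠ T.root → 2 * #(T.sub v) ≤ Fintype.card V) : 2 * j ≤ #(T.small j) := by
  classical
  by_cases hx : ∃ x, x ≠ T.root ∧ j < #(T.sub x)
  · obtain ⟨A, B, hd, hA, hB, hAj, hBj, -, -⟩ := T.exists_disjoint_pieces hj hsub hx
    have := card_le_card (union_subset hA hB)
    rw [card_union_of_disjoint hd] at this
    omega
  · push Not at hx
    have : univ.erase T.root ⊆ T.small j := fun v hv => mem_small.2 (hx v (ne_of_mem_erase hv))
    have := card_le_card this
    rw [card_erase_of_mem (mem_univ _), card_univ] at this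
    omega

/-- One leaf child for every support vertex. -/
lemma exists_matched_leaves : ∃ M : Finset V, #M = #T.supports ∧
    ∀ w ∈ M, T.IsLeaf w ∧ T.parent w ∈ T.supports ∧
      ∀ w' ∈ M, T.parent w = T.parent w' → w = w' := by
  classical
  have h : ∀ u ∈ T.supports, ∃ w, T.parent w = u ∧ T.IsLeaf w := fun u hu => by
    obtain ⟨w, -, h⟩ := mem_supports.1 hu
    exact ⟨w, h⟩
  choose! m hm using h
  refine ⟨T.supports.image m, card_image_of_injOn fun a ha b hb hab => ?_, ?_⟩
  · rw [← (hm a ha).1, hab, (hm b hb).1]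
  · intro w hw
    obtain ⟨u, hu, rfl⟩ := mem_image.1 hw
    refine ⟨(hm u hu).2, by rwa [(hm u hu).1], fun w' hw' h => ?_⟩
    obtain ⟨u', hu', rfl⟩ := mem_image.1 hw'
    rw [(hm u hu).1, (hm u' hu').1] at h
    rw [h]

open Classical in
lemma half_le_card_sdiff {M A : Finset V} {j : ℕ}
    (hM : ∀ w ∈ M, T.IsLeaf w ∧ T.parent w ∈ T.supports ∧
      ∀ w' ∈ M, T.parent w = T.parent w' → w = w')
    (hj : j ≤ #A) (hA : ∃ x, ∀ w ∈ A, T.parent w ∈ A ∨ T.parent w = x) :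
    j / 2 ≤ #(A \ M) := by
  obtain ⟨x, hx⟩ := hA
  have hle : #(A ∩ M) ≤ #(insert x (A \ M)) := by
    refine card_le_card_of_injOn T.parent ?_ ?_
    · intro w hw
      obtain ⟨hwA, hwM⟩ := mem_inter.1 hw
      rw [mem_coe, mem_insert, mem_sdiff]
      rcases hx w hwA with h | h
      · exact Or.inr ⟨h, fun h' =>
          (mem_supports.1 (hM w hwM).2.1).not_isLeaf (hM _ h').1⟩
      · exact Or.inl h
    · intro a ha b hb hab
      exact (hM a (mem_inter.1 ha).2).2.2 b (mem_inter.1 hb).2 hab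
  have h1 := card_insert_le x (A \ M)
  have h2 := card_sdiff_add_card_inter A M
  omega

lemma supports_add_le_card_small {j : ℕ} (hj0 : 0 < j) (hj : 2 * (j + 1) ≤ Fintype.card V)
    (hsub : ∀ v, v ≠ T.root → 2 * #(T.sub v) ≤ Fintype.card V) :
    min #T.supports (Fintype.card V / 2) + 2 * (j / 2) ≤ #(T.small j) := by
  classical
  by_cases hx : ∃ x, x ≠ T.root ∧ j < #(T.sub x)
  · obtain ⟨A, B, hd, hA, hB, hAj, hBj, hAx, hBy⟩ := T.exists_disjoint_pieces hj hsub hx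
    obtain ⟨M, hMc, hM⟩ := T.exists_matched_leaves
    have hMs : M ⊆ T.small j := by
      intro w hw
      rw [mem_small]
      have : T.sub w ⊆ {w} := fun v hv => by
        rw [mem_singleton]
        exact (hM w hw).1.eq_of_desc (mem_sub.1 hv)
      have := card_le_card this
      rw [card_singleton] at this
      omega
    have h1 := T.half_le_card_sdiff hM hAj hAx
    have h2 := T.half_le_card_sdiff hM hBj hBy
    have hu : M ∪ (A \ M ∪ B \ M) ⊆ T.small j :=
      union_subset hMs (union_subset (sdiff_subset.trans hA) (sdiff_subset.trans hB))
    have h3 := card_le_card hu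
    rw [card_union_of_disjoint, card_union_of_disjoint] at h3
    · omega
    · exact hd.mono sdiff_subset sdiff_subset
    · exact disjoint_union_right.2 ⟨disjoint_sdiff, disjoint_sdiff⟩
  · push Not at hx
    have : univ.erase T.root ⊆ T.small j := fun v hv => mem_small.2 (hx v (ne_of_mem_erase hv))
    have := card_le_card this
    rw [card_erase_of_mem (mem_univ _), card_univ] at this
    omega

end ParentMap

section Domination

lemma domNumber_le_card [Fintype V] (G : SimpleGraph V) (S : Finset V)
    (hS : ∀ v ∉ S, ∃ u ∈ S, G.Adj u v) : domNumber G ≤ #S :=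
  Nat.sInf_le ⟨S, by simpa using hS, Set.ncard_coe_finset S⟩

open Classical in
/-- A colouring of the vertices by three colours, with one extra colour on some vertices, such
that each vertex sees each colour in its closed neighbourhood. -/
lemma three_mul_domNumber_le [Fintype V] (G : SimpleGraph V) (R : Finset V) (f g : V → ZMod 3)
    (h : ∀ w i, ∃ u, (u = w ∨ G.Adj u w) ∧ (f u = i ∨ u ∈ R ∧ g u = i)) :
    3 * domNumber G ≤ Fintype.card V + #R := by
  have hle : ∀ i : ZMod 3, domNumber G ≤
      #(univ.filter fun u => f u = i) + #(R.filter fun u => g u = i) := by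
    intro i
    refine (domNumber_le_card G ((univ.filter fun u => f u = i) ∪ R.filter fun u => g u = i)
      fun v hv => ?_).trans (card_union_le _ _)
    obtain ⟨u, hu, hui⟩ := h v i
    have hmem : u ∈ (univ.filter fun u => f u = i) ∪ R.filter fun u => g u = i := by
      simpa using hui
    rcases hu with rfl | hu
    · exact absurd hmem hv
    · exact ⟨u, hmem, hu⟩
  have hsum := sum_le_sum fun i (_ : i ∈ (univ : Finset (ZMod 3))) => hle i
  rw [sum_add_distrib, ← card_eq_sum_card_fiberwise (fun _ _ => mem_univ _),
    ← card_eq_sum_card_fiberwise (fun _ _ => mem_univ _)] at hsum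
  simpa using hsum

namespace ParentMap

variable [Fintype V] (T : ParentMap V) {G : SimpleGraph V}

lemma three_mul_domNumber_le_of_sign (hG : ∀ v, v ≠ T.root → G.Adj (T.parent v) v)
    (e : V → ZMod 3) (he : ∀ v, e v ≠ 0)
    (hpar : ∀ w, w ≠ T.root → T.parent w ≠ T.root → e (T.parent w) = e w)
    (hleaf : ∀ w, w ≠ T.root → T.IsLeaf w → e (T.parent w) = e w)
    (hroot : ∀ i, i ≠ 0 → (∃ u, T.depth u = 1 ∧ e u = i) ∨
      T.IsSupport T.root ∧ - e T.root = i) :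
    3 * domNumber G ≤ Fintype.card V + #T.supports := by
  have hdepth : ∀ w, w ≠ T.root →
      ((T.depth w : ℕ) : ZMod 3) = (T.depth (T.parent w) : ℕ) + 1 := by
    intro w hw
    have := T.depth_pos hw
    rw [T.depth_parent, ← Nat.cast_succ]
    congr 1
    omega
  have hdr : ((T.depth T.root : ℕ) : ZMod 3) = 0 := by rw [T.depth_root, Nat.cast_zero]
  have hparent : ∀ w, w ≠ T.root →
      e (T.parent w) * (T.depth (T.parent w) : ℕ) = e w * (T.depth w : ℕ) - e w := by
    intro w hw
    rw [hdepth w hw]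
    by_cases hp : T.parent w = T.root
    · rw [hp, hdr]; ring
    · rw [hpar w hw hp]; ring
  refine three_mul_domNumber_le G T.supports (fun v => e v * (T.depth v : ℕ))
    (fun v => e v * (T.depth v : ℕ) - e v) fun w i => ?_
  by_cases hw : w = T.root
  · subst hw
    by_cases hi : i = 0
    · exact ⟨T.root, Or.inl rfl, Or.inl (by rw [hdr, hi, mul_zero])⟩
    rcases hroot i hi with ⟨u, hu, rfl⟩ | ⟨hs, hs'⟩
    · have hur : u ≠ T.root := by rintro rfl; rw [T.depth_root] at hu; omega
      have hpu : T.parent u = T.root := by rw [← T.depth_eq_zero, T.depth_parent, hu]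
      refine ⟨u, Or.inr ?_, Or.inl (by rw [hu, Nat.cast_one, mul_one])⟩
      rw [← hpu]
      exact (hG u hur).symm
    · exact ⟨T.root, Or.inl rfl, Or.inr ⟨mem_supports.2 hs, by rw [hdr, ← hs']; ring⟩⟩
  · have tri : ∀ e f i : ZMod 3, e ≠ 0 → i = f ∨ i = f - e ∨ i = f + e := by decide
    rcases tri (e w) (e w * (T.depth w : ℕ)) i (he w) with rfl | rfl | rfl
    · exact ⟨w, Or.inl rfl, Or.inl rfl⟩
    · exact ⟨T.parent w, Or.inr (hG w hw), Or.inl (hparent w hw)⟩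
    · by_cases hl : T.IsLeaf w
      · refine ⟨T.parent w, Or.inr (hG w hw),
          Or.inr ⟨mem_supports.2 ⟨w, hw, rfl, hl⟩, ?_⟩⟩
        rw [hparent w hw, hleaf w hw hl]
        have : ∀ a b : ZMod 3, a - b - b = a + b := by decide
        exact this _ _
      · unfold IsLeaf at hl
        push Not at hl
        obtain ⟨x, hx, rfl⟩ := hl
        refine ⟨x, Or.inr (hG x hx).symm, Or.inl ?_⟩
        rw [hparent x hx, hpar x hx hw]
        ring

lemma three_mul_domNumber_le (hG : ∀ v, v ≠ T.root → G.Adj (T.parent v) v)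
    (hcard : 3 ≤ Fintype.card V)
    (hsub : ∀ v, v ≠ T.root → 2 * #(T.sub v) ≤ Fintype.card V) :
    3 * domNumber G ≤ Fintype.card V + #T.supports := by
  classical
  have hcases : ∀ i : ZMod 3, i ≠ 0 → i = 1 ∨ i = -1 := by decide
  by_cases hs : T.IsSupport T.root
  · refine T.three_mul_domNumber_le_of_sign hG (fun _ => 1) (fun _ => one_ne_zero)
      (fun _ _ _ => rfl) (fun _ _ _ => rfl) fun i hi => ?_
    rcases hcases i hi with rfl | rfl
    · obtain ⟨w, hw, hwr, -⟩ := hs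
      refine Or.inl ⟨w, ?_, rfl⟩
      have h1 := T.depth_pos hw
      have h2 := T.depth_parent w
      rw [hwr, T.depth_root] at h2
      omega
    · exact Or.inr ⟨hs, rfl⟩
  · have : Nontrivial V := Fintype.one_lt_card_iff_nontrivial.1 (by omega)
    obtain ⟨v, hv⟩ := exists_ne T.root
    obtain ⟨u, hu, -⟩ := T.exists_branch hv
    have hur : u ≠ T.root := by rintro rfl; rw [T.depth_root] at hu; omega
    obtain ⟨v', hv'⟩ : ∃ v', v' ∉ insert T.root (T.sub u) := by
      by_contra! hcon
      have h1 : #(insert T.root (T.sub u)) = Fintype.card V := by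
        rw [eq_univ_of_forall hcon, card_univ]
      have h2 := card_insert_le T.root (T.sub u)
      have h3 := hsub u hur
      omega
    rw [mem_insert, not_or, mem_sub] at hv'
    obtain ⟨u', hu', huv'⟩ := T.exists_branch hv'.1
    have huu' : ¬ T.Desc u u' := fun h => hv'.2 (h.trans huv')
    have hpar : ∀ w, w ≠ T.root → T.parent w ≠ T.root →
        (if T.Desc u (T.parent w) then (-1 : ZMod 3) else 1) = if T.Desc u w then -1 else 1 := by
      intro w hw hp
      have : T.Desc u (T.parent w) ↔ T.Desc u w := by
        refine ⟨Desc.of_parent, fun h => h.parent ?_⟩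
        rintro rfl
        exact hp (by rw [← T.depth_eq_zero, T.depth_parent, hu])
      simp only [this]
    refine T.three_mul_domNumber_le_of_sign hG (fun w => if T.Desc u w then -1 else 1) ?_ hpar
      (fun w hw hl => hpar w hw fun hp => hs ⟨w, hw, hp, hl⟩) fun i hi => Or.inl ?_
    · intro w
      split_ifs <;> decide
    · rcases hcases i hi with rfl | rfl
      · exact ⟨u', hu', if_neg huu'⟩
      · exact ⟨u, hu, if_pos (T.desc_refl u)⟩

end ParentMap

end Domination

section Median

/-- A breadth-first search tree of a connected graph. -/
lemma exists_parentMap (G : SimpleGraph V) (hG : G.Connected) (c : V) :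
    ∃ T : ParentMap V, T.root = c ∧ (∀ v, T.depth v = G.dist c v) ∧
      ∀ v, v ≠ T.root → G.Adj (T.parent v) v := by
  classical
  have h : ∀ v, v ≠ c → ∃ u, G.Adj u v ∧ G.dist c u = G.dist c v - 1 := by
    intro v hv
    obtain ⟨q, hq⟩ := hG.exists_walk_length_eq_dist v c
    cases q with
    | nil => exact absurd rfl hv
    | @cons _ u _ hadj q =>
      refine ⟨u, hadj.symm, ?_⟩
      have h1 := SimpleGraph.dist_le q
      have h2 := hG.dist_triangle (u := v) (v := u) (w := c)
      have h3 := SimpleGraph.dist_eq_one_iff_adj.2 hadj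
      rw [SimpleGraph.Walk.length_cons] at hq
      rw [SimpleGraph.dist_comm (u := c), SimpleGraph.dist_comm (u := c)]
      omega
  choose! p hp using h
  refine ⟨⟨c, fun v => if v = c then c else p v, G.dist c, fun v => ?_, fun v => ?_⟩,
    rfl, fun _ => rfl, fun v hv => ?_⟩
  · split_ifs with hv
    · simp [hv]
    · exact (hp v hv).2
  · rw [hG.dist_eq_zero_iff, eq_comm]
  · dsimp only at hv ⊢
    rw [if_neg hv]
    exact (hp v hv).1

lemma dist_iterate_parent_le {G : SimpleGraph V} (hG : G.Connected) (T : ParentMap V)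
    (hadj : ∀ v, v ≠ T.root → G.Adj (T.parent v) v) (k : ℕ) (w : V) :
    G.dist (T.parent^[k] w) w ≤ k := by
  induction k with
  | zero => simp
  | succ k ih =>
    rw [Function.iterate_succ_apply']
    by_cases h : T.parent^[k] w = T.root
    · rw [h, T.parent_root, ← h]
      omega
    · have h1 := hG.dist_triangle (u := T.parent (T.parent^[k] w)) (v := T.parent^[k] w) (w := w)
      have h2 := SimpleGraph.dist_eq_one_iff_adj.2 (hadj _ h)
      omega

/-- Every branch at a vertex of minimum status contains at most half of the vertices. -/
lemma two_mul_card_sub_le [Fintype V] {G : SimpleGraph V} (hG : G.Connected) (T : ParentMap V)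
    (hdepth : ∀ v, T.depth v = G.dist T.root v)
    (hadj : ∀ v, v ≠ T.root → G.Adj (T.parent v) v)
    (hmin : ∀ v, status G T.root ≤ status G v) (v : V) (hv : v ≠ T.root) :
    2 * #(T.sub v) ≤ Fintype.card V := by
  classical
  obtain ⟨u, hu, huv⟩ := T.exists_branch hv
  have hle : #(T.sub v) ≤ #(T.sub u) :=
    card_le_card fun w hw => ParentMap.mem_sub.2 (huv.trans (ParentMap.mem_sub.1 hw))
  have hpt : ∀ w, G.dist u w + (if w ∈ T.sub u then 2 else 0) ≤ G.dist T.root w + 1 := by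
    intro w
    split_ifs with hw
    · obtain ⟨k, hk⟩ := ParentMap.mem_sub.1 hw
      have h1 := dist_iterate_parent_le hG T hadj k w
      have h2 := T.depth_iterate k w
      rw [hk] at h1 h2
      rw [← hdepth w]
      omega
    · have h1 := hG.dist_triangle (u := u) (v := T.root) (w := w)
      rw [SimpleGraph.dist_comm (u := u) (v := T.root), ← hdepth u] at h1
      omega
  have hsum := sum_le_sum fun w (_ : w ∈ (univ : Finset V)) => hpt w
  rw [sum_add_distrib, sum_add_distrib, ← sum_filter, sum_const, sum_const] at hsum
  have := hmin u
  unfold status at this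
  simp only [filter_univ_mem, smul_eq_mul, mul_one, card_univ] at hsum
  omega

end Median

lemma sq_div_four_le (s : ℕ) : (s + 1) ^ 2 / 4 ≤ s ^ 2 / 4 + (s + 1) / 2 := by
  obtain ⟨k, rfl | rfl⟩ := Nat.even_or_odd' s
  · have h1 : (2 * k + 1) ^ 2 = 4 * (k ^ 2 + k) + 1 := by ring
    have h2 : (2 * k) ^ 2 = 4 * k ^ 2 := by ring
    omega
  · have h1 : (2 * k + 1 + 1) ^ 2 = 4 * (k ^ 2 + 2 * k + 1) := by ring
    have h2 : (2 * k + 1) ^ 2 = 4 * (k ^ 2 + k) + 1 := by ring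
    omega

lemma mul_pred_add_le_sum {a : ℕ → ℕ} {h t : ℕ} (ht : 1 ≤ t) (hth : t ≤ h)
    (ha : ∀ j < h, 2 * j ≤ a j) (ha' : ∀ j < h, 0 < j → t + 2 * (j / 2) ≤ a j) :
    h * (h - 1) + 2 * ((t - 1) ^ 2 / 4) ≤ ∑ j ∈ range h, a j := by
  have base : ∀ s < t, s * t + 2 * (s ^ 2 / 4) ≤ ∑ j ∈ range (s + 1), a j := by
    intro s hs
    induction s with
    | zero => simp
    | succ s ih =>
      rw [sum_range_succ]
      have h1 := ih (by omega)
      have h2 := ha' (s + 1) (by omega) (by omega)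
      have h3 := sq_div_four_le s
      rw [Nat.succ_mul]
      omega
  have step : ∀ s, t ≤ s → s ≤ h →
      s * (s - 1) + 2 * ((t - 1) ^ 2 / 4) ≤ ∑ j ∈ range s, a j := by
    intro s hs
    induction s, hs using Nat.le_induction with
    | base =>
      intro _
      have := base (t - 1) (by omega)
      rwa [Nat.sub_add_cancel ht, mul_comm (t - 1)] at this
    | succ s hs ih =>
      intro hsh
      rw [sum_range_succ]
      have h1 := ih (by omega)
      have h2 := ha s (by omega)
      obtain ⟨r, rfl⟩ : ∃ r, s = r + 1 := ⟨s - 1, by omega⟩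
      have h3 : (r + 1 + 1) * (r + 1 + 1 - 1) = (r + 1) * (r + 1 - 1) + 2 * (r + 1) := by
        simp only [Nat.add_sub_cancel]; ring
      omega
  exact step h hth le_rfl

/-- The bound in terms of the excess `t = 3γ - n`. -/
lemma bound_arith {n γ s : ℕ} (h1 : (n + 2) / 3 < γ) (h2 : 2 * γ ≤ n)
    (hs : s + ((n / 2) * (n / 2 - 1) + 2 * ((3 * γ - n - 1) ^ 2 / 4)) ≤ (n / 2) * (n - 1)) :
    s ≤ 3 * n * γ + 3 * γ - n - (n ^ 2 + 18 * γ ^ 2 + 3) / 4 := by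
  obtain ⟨t, ht⟩ : ∃ t, 3 * γ = n + t + 1 := ⟨3 * γ - n - 1, by omega⟩
  have e1 : 3 * n * γ = n * (n + t + 1) := by rw [← ht]; ring
  have e2 : 18 * γ ^ 2 = 2 * (n + t + 1) ^ 2 := by rw [← ht]; ring
  have e3 : 3 * γ - n - 1 = t := by omega
  rw [e3] at hs
  rw [e1, e2, ht]
  have hq : t ^ 2 ≤ 4 * (t ^ 2 / 4) + 1 := by
    obtain ⟨k, rfl | rfl⟩ := Nat.even_or_odd' t
    · have : (2 * k) ^ 2 = 4 * k ^ 2 := by ring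
      omega
    · have : (2 * k + 1) ^ 2 = 4 * (k ^ 2 + k) + 1 := by ring
      omega
  have hH : 4 * ((n / 2) * (n - 1)) ≤ n ^ 2 + 4 * ((n / 2) * (n / 2 - 1)) := by
    obtain ⟨h, hh⟩ : ∃ h, n / 2 = h + 1 := ⟨n / 2 - 1, by omega⟩
    obtain hn | hn : n = 2 * h + 2 ∨ n = 2 * h + 3 := by omega
    all_goals
      rw [hh, hn]
      simp only [Nat.add_sub_cancel, Nat.reduceSubDiff, Nat.add_one_sub_one]
      nlinarith
  have hexp : 4 * (n * (n + t + 1)) + 4 * (t + 1) + 2 * t ^ 2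
      = n ^ 2 + 2 * (n + t + 1) ^ 2 + n ^ 2 + 2 := by ring
  omega

end StatusBound

/-- Upper bound on the minimum status of a connected graph with order `n` and
domination number `γ` with `⌈n/3⌉ < γ ≤ ⌊n/2⌋`. -/
theorem stmt17 [Fintype V] (G : SimpleGraph V) (n γ : ℕ)
    (hn : Fintype.card V = n) (hG : G.Connected)
    (hγ : domNumber G = γ) (h1 : (n + 2) / 3 < γ) (h2 : 2 * γ ≤ n) :
    minStatus G ≤ 3 * n * γ + 3 * γ - n - (n ^ 2 + 18 * γ ^ 2 + 3) / 4 := by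
  classical
  have hne : Nonempty V := hG.nonempty
  obtain ⟨c, -, hc⟩ := Finset.exists_min_image Finset.univ (status G)
    (Finset.univ_nonempty_iff.2 hne)
  obtain ⟨T, rfl, hdepth, hadj⟩ := exists_parentMap G hG c
  have hsub := two_mul_card_sub_le hG T hdepth hadj fun v => hc v (Finset.mem_univ v)
  have hdom := T.three_mul_domNumber_le hadj (by omega) hsub
  have hle : minStatus G ≤ status G T.root := Nat.sInf_le ⟨T.root, rfl⟩
  refine hle.trans (bound_arith h1 h2 ?_)
  have hstatus : status G T.root = ∑ w, T.depth w := by simp only [status, hdepth]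
  have hupper := T.sum_depth_add_sum_card_small_le (n / 2) (by omega)
    fun v hv => by have := hsub v hv; omega
  have hlower := mul_pred_add_le_sum (a := fun j => (T.small j).card) (h := n / 2)
    (t := 3 * γ - n) (by omega) (by omega)
    (fun j hj => T.two_mul_le_card_small (by omega) hsub)
    (fun j hj hj0 => by
      have := T.supports_add_le_card_small hj0 (by omega) hsub
      omega)
  rw [hn] at hupper
  omega
end
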